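/- For every integer n with 0 ≤ n ≤ 24, the quadratic form (log 2π)(∑_{i=0}^n x_i)² − ∑_{0≤i,j≤n} x_i x_j ψ(1/2 + |i−j|) is positive definite on ℝ^{n+1}, where ψ is the digamma function; for n ≥ 25 it is not positive definite, and in fact for n ≥ 25 it takes a negative value on the vector with k-th coordinate C(2k,k)·C(2(n−k), n−k). -/

import Mathlib

open Finset

/-- The digamma function `ψ = Γ'/Γ` on the reals. -/
noncomputable def digamma (x : ℝ) : ℝ :=
  deriv (fun y => Real.log (Real.Gamma y)) x

/-- The quadratic form `(log 2π)(∑ xᵢ)² − ∑ xᵢ xⱼ ψ(1/2 + |i−j|)`. -/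
noncomputable def Q (n : ℕ) (x : Fin (n + 1) → ℝ) : ℝ :=
  Real.log (2 * Real.pi) * (∑ i, x i) ^ 2 -
    ∑ i, ∑ j, x i * x j * digamma (1/2 + |(i.1 : ℝ) - (j.1 : ℝ)|)

/-- The sum `∑ 1 / (2 * j + 1)` over `j < |m|`, as an even function of the integer `m`. -/
noncomputable def oddHarmonic (m : ℤ) : ℝ :=
  ∑ j ∈ range m.natAbs, 1 / (2 * (j : ℝ) + 1)

lemma oddHarmonic_natCast (m : ℕ) :
    oddHarmonic m = ∑ j ∈ range m, 1 / (2 * (j : ℝ) + 1) := rfl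

lemma oddHarmonic_neg (m : ℤ) : oddHarmonic (-m) = oddHarmonic m := by
  simp [oddHarmonic]

lemma oddHarmonic_add_one (m : ℤ) :
    oddHarmonic (m + 1) - oddHarmonic m = 1 / (2 * (m : ℝ) + 1) := by
  rcases le_or_gt 0 m with hm | hm
  · lift m to ℕ using hm
    rw [← Nat.cast_succ, oddHarmonic_natCast, oddHarmonic_natCast, sum_range_succ]
    simp
  · obtain ⟨k, rfl⟩ : ∃ k : ℕ, m = -(k + 1 : ℤ) := ⟨(-m - 1).toNat, by omega⟩
    have h1 : (-(k + 1 : ℤ) + 1) = -(k : ℤ) := by ring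
    rw [h1, oddHarmonic_neg, oddHarmonic_neg, ← Nat.cast_succ, oddHarmonic_natCast,
      oddHarmonic_natCast, sum_range_succ]
    have h2 : (2 * ((-((k + 1 : ℕ) : ℤ) : ℤ) : ℝ) + 1) = -(2 * (k : ℝ) + 1) := by
      push_cast; ring
    rw [h2, div_neg]
    ring

lemma digamma_add_one {x : ℝ} (hx : 0 < x) : digamma (x + 1) = digamma x + 1 / x := by
  unfold digamma
  have hG : ∀ y : ℝ, 0 < y → DifferentiableAt ℝ Real.Gamma y := fun y hy =>
    Real.differentiableAt_Gamma fun m => by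
      have : (0 : ℝ) ≤ m := m.cast_nonneg
      linarith
  rw [← deriv_comp_add_const]
  have he : (fun y => Real.log (Real.Gamma (y + 1))) =ᶠ[nhds x]
      fun y => Real.log (Real.Gamma y) + Real.log y := by
    filter_upwards [lt_mem_nhds hx] with y hy
    rw [Real.Gamma_add_one hy.ne', Real.log_mul hy.ne' (Real.Gamma_pos_of_pos hy).ne', add_comm]
  rw [he.deriv_eq, deriv_fun_add ((hG x hx).log (Real.Gamma_pos_of_pos hx).ne')
    (Real.differentiableAt_log hx.ne'), Real.deriv_log, one_div]

lemma digamma_one_half :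
    digamma (1 / 2) = -Real.eulerMascheroniConstant - 2 * Real.log 2 := by
  have h := Real.hasDerivAt_Gamma_one_half.log
    (Real.Gamma_pos_of_pos (by norm_num : (0 : ℝ) < 1 / 2)).ne'
  unfold digamma
  rw [h.deriv, Real.Gamma_one_half_eq]
  have : √Real.pi ≠ 0 := (Real.sqrt_pos.2 Real.pi_pos).ne'
  field_simp
  ring

lemma digamma_one_half_add_natCast (m : ℕ) :
    digamma (1 / 2 + m) =
      -Real.eulerMascheroniConstant - 2 * Real.log 2 + 2 * oddHarmonic m := by
  induction m with
  | zero => simpa [oddHarmonic] using digamma_one_half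
  | succ m ih =>
    have h := oddHarmonic_add_one m
    rw [Nat.cast_succ, ← add_assoc, digamma_add_one (by positivity), ih, Nat.cast_succ]
    rw [sub_eq_iff_eq_add] at h
    rw [h]
    push_cast
    field_simp
    ring

lemma digamma_one_half_add_abs_sub (i j : ℕ) :
    digamma (1 / 2 + |(i : ℝ) - (j : ℝ)|) =
      -Real.eulerMascheroniConstant - 2 * Real.log 2 + 2 * oddHarmonic ((i : ℤ) - j) := by
  have h : |(i : ℝ) - (j : ℝ)| = (((i : ℤ) - j).natAbs : ℝ) := by
    rw [Nat.cast_natAbs]; push_cast; rfl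
  rw [h, digamma_one_half_add_natCast, oddHarmonic, Int.natAbs_natCast, oddHarmonic]

lemma sum_range_sub_mul (s f : ℕ → ℝ) (n : ℕ) :
    ∑ i ∈ range (n + 1), (s (i + 1) - s i) * f i =
      s (n + 1) * f n - s 0 * f 0 - ∑ i ∈ range n, s (i + 1) * (f (i + 1) - f i) := by
  induction n with
  | zero => simp; ring
  | succ n ih => rw [sum_range_succ, ih, sum_range_succ _ n]; ring

lemma harmonic_succ_real (n : ℕ) :
    (harmonic (n + 1) : ℝ) = harmonic n + 1 / ((n : ℝ) + 1) := by
  rw [harmonic_succ]; push_cast; rw [one_div]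

lemma log_pi_lt : Real.log Real.pi < 23 / 20 := by
  have h : Real.pi ^ 20 < Real.exp 1 ^ 23 :=
    calc Real.pi ^ 20 < 3.1416 ^ 20 := by gcongr; exact Real.pi_lt_d4
      _ < 2.7182818283 ^ 23 := by norm_num
      _ < Real.exp 1 ^ 23 := by gcongr; exact Real.exp_one_gt_d9
  have h' := Real.log_lt_log (by positivity) h
  rw [Real.log_pow, Real.log_pow, Real.log_exp] at h'
  push_cast at h'
  linarith

lemma lt_log_pi : 8 / 7 < Real.log Real.pi := by
  have h : Real.exp 1 ^ 8 < Real.pi ^ 7 :=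
    calc Real.exp 1 ^ 8 < 2.7182818286 ^ 8 := by gcongr; exact Real.exp_one_lt_d9
      _ < 3.1415 ^ 7 := by norm_num
      _ < Real.pi ^ 7 := by gcongr; exact Real.pi_gt_d4
  have h' := Real.log_lt_log (by positivity) h
  rw [Real.log_pow, Real.log_pow, Real.log_exp] at h'
  push_cast at h'
  linarith

lemma threshold_lt_harmonic :
    Real.log (2 * Real.pi) + Real.eulerMascheroniConstant + 2 * Real.log 2 < harmonic 25 := by
  have h := Real.eulerMascheroniConstant_lt_eulerMascheroniSeq' 64
  have e : Real.log (64 : ℕ) = 6 * Real.log 2 := by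
    rw [show ((64 : ℕ) : ℝ) = 2 ^ 6 by norm_num, Real.log_pow]; norm_num
  rw [Real.eulerMascheroniSeq', if_neg (by norm_num), e] at h
  rw [Real.log_mul two_ne_zero Real.pi_ne_zero]
  have h1 := log_pi_lt
  have h2 := Real.log_two_gt_d9
  have h3 : (harmonic 64 : ℝ) < harmonic 25 + 0.928 := by
    simp only [harmonic, sum_range_succ, sum_range_zero]
    norm_num
  linarith

lemma harmonic_lt_threshold :
    (harmonic 24 : ℝ) <
      Real.log (2 * Real.pi) + Real.eulerMascheroniConstant + 2 * Real.log 2 := by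
  have h := Real.eulerMascheroniSeq_lt_eulerMascheroniConstant 63
  have e : Real.log ((63 : ℕ) + 1) = 6 * Real.log 2 := by
    rw [show ((63 : ℕ) + 1 : ℝ) = 2 ^ 6 by norm_num, Real.log_pow]; norm_num
  rw [Real.eulerMascheroniSeq, e] at h
  rw [Real.log_mul two_ne_zero Real.pi_ne_zero]
  have h1 := lt_log_pi
  have h2 := Real.log_two_lt_d9
  have h3 : (harmonic 24 : ℝ) + 0.952 < harmonic 63 := by
    simp only [harmonic, sum_range_succ, sum_range_zero]
    norm_num
  linarith

lemma harmonic_mono : Monotone fun n => (harmonic n : ℝ) :=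
  monotone_nat_of_le_succ fun n => by
    rw [harmonic_succ_real]
    have : 0 ≤ 1 / ((n : ℝ) + 1) := by positivity
    linarith

lemma sum_mul_oddHarmonic_neg {n : ℕ} {z : ℕ → ℝ} (hz : ∑ k ∈ range (n + 1), z k = 0)
    (hne : ∃ k ≤ n, z k ≠ 0) :
    ∑ i ∈ range (n + 1), ∑ j ∈ range (n + 1), z i * z j * oddHarmonic ((i : ℤ) - j) < 0 := by
  set s : ℕ → ℝ := fun i => ∑ k ∈ range i, z k with hs
  have hzs : ∀ i, z i = s (i + 1) - s i := fun i => by simp [hs, sum_range_succ]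
  have hs0 : s 0 = 0 := by simp [hs]
  have hsn : s (n + 1) = 0 := hz
  -- the difference quotients of `oddHarmonic`, and the resulting Toeplitz kernel
  set g : ℤ → ℝ := fun m => 1 / (2 * (m : ℝ) + 1) with hg
  set G : ℕ → ℕ → ℝ := fun i j => g ((i : ℤ) - j) - g ((i : ℤ) - j - 1) with hG
  have key : ∑ i ∈ range (n + 1), ∑ j ∈ range (n + 1), z i * z j * oddHarmonic ((i : ℤ) - j) =
      -∑ i ∈ range n, ∑ j ∈ range n, s (i + 1) * s (j + 1) * G i j := by
    calc _ = ∑ i ∈ range (n + 1), (s (i + 1) - s i) *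
          ∑ j ∈ range (n + 1), z j * oddHarmonic ((i : ℤ) - j) := by
          refine sum_congr rfl fun i _ => ?_
          rw [← hzs, mul_sum]
          exact sum_congr rfl fun j _ => by ring
      _ = -∑ i ∈ range n, s (i + 1) * ∑ j ∈ range (n + 1), (s (j + 1) - s j) * g ((i : ℤ) - j) := by
          rw [sum_range_sub_mul s (fun i => ∑ j ∈ range (n + 1), z j * oddHarmonic ((i : ℤ) - j)),
            hs0, hsn, zero_mul, zero_mul, sub_zero, zero_sub]
          congr 1
          refine sum_congr rfl fun i _ => ?_
          rw [← sum_sub_distrib]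
          congr 1
          refine sum_congr rfl fun j _ => ?_
          have h := oddHarmonic_add_one ((i : ℤ) - j)
          rw [← hzs, ← mul_sub, hg]
          rw [show ((i + 1 : ℕ) : ℤ) - j = (i : ℤ) - j + 1 by push_cast; ring, h]
      _ = _ := by
          congr 1
          refine sum_congr rfl fun i _ => ?_
          rw [sum_range_sub_mul s (fun j => g ((i : ℤ) - j)), hs0, hsn, zero_mul, zero_mul,
            sub_zero, zero_sub, ← sum_neg_distrib, mul_sum]
          refine sum_congr rfl fun j _ => ?_
          rw [show (i : ℤ) - (j + 1 : ℕ) = (i : ℤ) - j - 1 by push_cast; ring]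
          simp only [hG]
          ring
  have hGsymm : ∀ i j, G i j = G j i := fun i j => by
    have hneg : ∀ m : ℤ, g (-m) = -g (m - 1) := fun m => by
      simp only [hg]
      rw [← one_div_neg_eq_neg_one_div]
      push_cast
      ring_nf
    have h1 := hneg ((j : ℤ) - i)
    have h2 := hneg ((j : ℤ) - i + 1)
    simp only [hG]
    rw [show (i : ℤ) - j = -((j : ℤ) - i) by ring, h1,
      show -((j : ℤ) - i) - 1 = -((j : ℤ) - i + 1) by ring, h2, add_sub_cancel_right]
    ring
  have hGneg : ∀ i j, i < j → G i j ≤ 0 := fun i j hij => by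
    simp only [hG, hg]
    have : (i : ℝ) + 1 ≤ j := by exact_mod_cast hij
    push_cast
    rw [sub_nonpos]
    apply one_div_le_one_div_of_neg_of_le <;> linarith
  have hGoff : ∀ i j, i ≠ j → G i j ≤ 0 := fun i j hij => by
    rcases lt_or_gt_of_ne hij with h | h
    · exact hGneg i j h
    · rw [hGsymm]; exact hGneg j i h
  have hrow : ∀ i < n, 0 < ∑ j ∈ range n, G i j := fun i hi => by
    have := sum_range_sub' (fun j : ℕ => g ((i : ℤ) - j)) n
    have h2 : ∑ j ∈ range n, G i j = g i - g ((i : ℤ) - n) := by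
      rw [Nat.cast_zero, sub_zero] at this
      rw [← this]
      simp [hG, sub_sub]
    rw [h2]
    simp only [hg]
    have hi' : (i : ℝ) + 1 ≤ n := by exact_mod_cast hi
    have h3 : 1 / (2 * (((i : ℤ) - n : ℤ) : ℝ) + 1) < 0 := by
      apply one_div_neg.2
      push_cast
      linarith
    have h4 : 0 < 1 / (2 * ((i : ℤ) : ℝ) + 1) := by push_cast; positivity
    linarith
  have hsq : ∑ i ∈ range n, ∑ j ∈ range n, s (i + 1) * s (j + 1) * G i j =
      ∑ i ∈ range n, s (i + 1) ^ 2 * ∑ j ∈ range n, G i j -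
        (1 / 2) * ∑ i ∈ range n, ∑ j ∈ range n, G i j * (s (i + 1) - s (j + 1)) ^ 2 := by
    have h1 : ∑ i ∈ range n, ∑ j ∈ range n, s (i + 1) ^ 2 * G i j =
        ∑ i ∈ range n, ∑ j ∈ range n, s (j + 1) ^ 2 * G i j := by
      rw [sum_comm]
      exact sum_congr rfl fun i _ => sum_congr rfl fun j _ => by rw [hGsymm]
    have h2 : ∑ i ∈ range n, ∑ j ∈ range n, G i j * (s (i + 1) - s (j + 1)) ^ 2 =
        ∑ i ∈ range n, ∑ j ∈ range n, s (i + 1) ^ 2 * G i j +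
        ∑ i ∈ range n, ∑ j ∈ range n, s (j + 1) ^ 2 * G i j -
        2 * ∑ i ∈ range n, ∑ j ∈ range n, s (i + 1) * s (j + 1) * G i j := by
      simp only [mul_sum, ← sum_add_distrib, ← sum_sub_distrib]
      exact sum_congr rfl fun i _ => sum_congr rfl fun j _ => by ring
    rw [h2, ← h1]
    simp only [mul_sum (range n) _ (s _ ^ 2)]
    ring
  have hoff : ∑ i ∈ range n, ∑ j ∈ range n, G i j * (s (i + 1) - s (j + 1)) ^ 2 ≤ 0 :=
    sum_nonpos fun i _ => sum_nonpos fun j _ => by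
      by_cases h : i = j
      · simp [h]
      · exact mul_nonpos_of_nonpos_of_nonneg (hGoff i j h) (sq_nonneg _)
  have hex : ∃ i < n, s (i + 1) ≠ 0 := by
    by_contra! hcon
    have hall : ∀ i ≤ n + 1, s i = 0 := fun i hi => by
      rcases i with _ | i
      · exact hs0
      · rcases Nat.lt_or_ge i n with h | h
        · exact hcon i h
        · obtain rfl : i = n := by omega
          exact hsn
    obtain ⟨k, hk, hzk⟩ := hne
    exact hzk (by rw [hzs, hall _ (by omega), hall _ (by omega), sub_zero])
  have hdiag : 0 < ∑ i ∈ range n, s (i + 1) ^ 2 * ∑ j ∈ range n, G i j := by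
    obtain ⟨i, hi, hsi⟩ := hex
    refine sum_pos' (fun i hi => ?_) ⟨i, mem_range.2 hi, ?_⟩
    · exact mul_nonneg (sq_nonneg _) (hrow i (mem_range.1 hi)).le
    · exact mul_pos (by positivity) (hrow i hi)
  rw [key, hsq]
  linarith

lemma centralBinom_succ_real (k : ℕ) :
    ((k : ℝ) + 1) * (k + 1).centralBinom = 2 * (2 * k + 1) * k.centralBinom := by
  exact_mod_cast Nat.succ_mul_centralBinom_succ k

open PowerSeries in
lemma centralBinom_powerSeries_derivative :
    (1 - 4 * X) * d⁄dX ℝ (PowerSeries.mk fun k : ℕ => (k.centralBinom : ℝ)) =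
      2 * PowerSeries.mk fun k : ℕ => (k.centralBinom : ℝ) := by
  ext k
  have e4 : (4 : PowerSeries ℝ) = C 4 := (map_ofNat C 4).symm
  have e2 : (2 : PowerSeries ℝ) = C 2 := (map_ofNat C 2).symm
  have h := centralBinom_succ_real k
  rw [sub_mul, one_mul, e4, e2, mul_assoc, map_sub, coeff_C_mul, coeff_C_mul, coeff_derivative,
    coeff_mk, coeff_mk]
  rcases k with _ | k
  · simp at h ⊢; linarith
  · rw [coeff_succ_X_mul, coeff_derivative, coeff_mk]
    push_cast at h ⊢
    linarith

open PowerSeries in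
lemma centralBinom_oddHarmonic_powerSeries_derivative :
    (1 - 4 * X) * d⁄dX ℝ (PowerSeries.mk fun k : ℕ => (k.centralBinom : ℝ) * (2 * oddHarmonic k)) =
      2 * (PowerSeries.mk fun k : ℕ => (k.centralBinom : ℝ) * (2 * oddHarmonic k)) +
        4 * PowerSeries.mk fun k : ℕ => (k.centralBinom : ℝ) := by
  ext k
  have e4 : (4 : PowerSeries ℝ) = C 4 := (map_ofNat C 4).symm
  have e2 : (2 : PowerSeries ℝ) = C 2 := (map_ofNat C 2).symm
  have h := centralBinom_succ_real k
  have ho := oddHarmonic_add_one k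
  rw [sub_mul, one_mul, e4, e2, mul_assoc, map_sub, map_add, coeff_C_mul, coeff_C_mul,
    coeff_C_mul, coeff_derivative, coeff_mk, coeff_mk, coeff_mk]
  have hk : (2 * (k : ℝ) + 1) ≠ 0 := by positivity
  rw [sub_eq_iff_eq_add] at ho
  have h2 : ((k + 1).centralBinom : ℝ) * (2 * oddHarmonic (k + 1 : ℕ)) * ((k : ℝ) + 1) =
      2 * (2 * k + 1) * (k.centralBinom * (2 * oddHarmonic k)) + 4 * k.centralBinom := by
    calc _ = (((k : ℝ) + 1) * (k + 1).centralBinom) * (2 * oddHarmonic (k + 1 : ℕ)) := by ring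
      _ = _ := by
        rw [h, Nat.cast_succ, ho]
        push_cast
        field_simp
        ring
  rw [h2]
  rcases k with _ | k
  · simp [oddHarmonic]
  · rw [coeff_succ_X_mul, coeff_derivative, coeff_mk]
    push_cast
    ring

lemma sum_range_eq_coeff_mul (f g : ℕ → ℝ) (n : ℕ) :
    ∑ k ∈ range (n + 1), f k * g (n - k) =
      PowerSeries.coeff n (PowerSeries.mk f * PowerSeries.mk g) := by
  rw [PowerSeries.coeff_mul, Nat.sum_antidiagonal_eq_sum_range_succ_mk]
  simp

open PowerSeries in
lemma sum_centralBinom_mul_centralBinom (n : ℕ) :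
    ∑ k ∈ range (n + 1), (k.centralBinom : ℝ) * (n - k).centralBinom = 4 ^ n := by
  rw [sum_range_eq_coeff_mul (fun k => (k.centralBinom : ℝ)) fun k => (k.centralBinom : ℝ)]
  have hB := centralBinom_powerSeries_derivative
  set B : PowerSeries ℝ := PowerSeries.mk fun k : ℕ => (k.centralBinom : ℝ) with hBdef
  have hBB : d⁄dX ℝ (B * B) = 4 * (X * d⁄dX ℝ (B * B)) + 4 * (B * B) := by
    rw [Derivation.leibniz, smul_eq_mul]
    linear_combination (2 * B) * hB
  have e4 : (4 : PowerSeries ℝ) = C 4 := (map_ofNat C 4).symm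
  have hrec : ∀ n : ℕ, coeff (n + 1) (B * B) = 4 * coeff n (B * B) := fun n => by
    have h := congrArg (coeff n) hBB
    rw [map_add, e4, coeff_C_mul, coeff_C_mul, coeff_derivative] at h
    have hn : (n : ℝ) + 1 ≠ 0 := by positivity
    apply mul_right_cancel₀ hn
    rw [h]
    rcases n with _ | n
    · simp
    · rw [coeff_succ_X_mul, coeff_derivative]
      push_cast
      ring
  induction n with
  | zero => simp [hBdef]
  | succ n ih => rw [hrec, ih]; ring

open PowerSeries in
lemma sum_centralBinom_mul_centralBinom_mul_oddHarmonic (n : ℕ) :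
    ∑ k ∈ range (n + 1), (k.centralBinom : ℝ) * (n - k).centralBinom * oddHarmonic k =
      4 ^ n * harmonic n / 2 := by
  have hsum := sum_range_eq_coeff_mul (fun k => (k.centralBinom : ℝ) * (2 * oddHarmonic k))
    (fun k => (k.centralBinom : ℝ))
  have hBBn := fun n => (sum_range_eq_coeff_mul (fun k => (k.centralBinom : ℝ))
    (fun k => (k.centralBinom : ℝ)) n).symm.trans (sum_centralBinom_mul_centralBinom n)
  have hB := centralBinom_powerSeries_derivative
  have hD := centralBinom_oddHarmonic_powerSeries_derivative
  set B : PowerSeries ℝ := PowerSeries.mk fun k : ℕ => (k.centralBinom : ℝ) with hBdef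
  set D : PowerSeries ℝ := PowerSeries.mk fun k : ℕ => (k.centralBinom : ℝ) * (2 * oddHarmonic k) with hDdef
  have hDB : d⁄dX ℝ (D * B) = 4 * (X * d⁄dX ℝ (D * B)) + 4 * (D * B) + 4 * (B * B) := by
    rw [Derivation.leibniz, smul_eq_mul, smul_eq_mul]
    linear_combination D * hB + B * hD
  have e4 : (4 : PowerSeries ℝ) = C 4 := (map_ofNat C 4).symm
  have hrec : ∀ n : ℕ, coeff (n + 1) (D * B) = 4 * coeff n (D * B) + 4 ^ (n + 1) / ((n : ℝ) + 1) :=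
    fun n => by
    have h := congrArg (coeff n) hDB
    rw [map_add, map_add, e4, coeff_C_mul, coeff_C_mul, coeff_C_mul, coeff_derivative, hBBn] at h
    have hn : (n : ℝ) + 1 ≠ 0 := by positivity
    apply mul_right_cancel₀ hn
    rw [h, add_mul, div_mul_cancel₀ _ hn]
    rcases n with _ | n
    · simp
    · rw [coeff_succ_X_mul, coeff_derivative]
      push_cast
      ring
  have hcoeff : ∀ n : ℕ, coeff n (D * B) = 4 ^ n * harmonic n := fun n => by
    induction n with
    | zero => simp [hDdef, oddHarmonic]
    | succ n ih => rw [hrec, ih, harmonic_succ_real]; ring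
  rw [← hcoeff, ← hsum, sum_div]
  exact sum_congr rfl fun k _ => by ring

lemma prod_range_sub_add_half (k : ℕ) :
    ∏ j ∈ range k, ((k : ℝ) - (j + 1 / 2)) = k.centralBinom * k.factorial / 4 ^ k := by
  induction k with
  | zero => simp
  | succ k ih =>
    have h := centralBinom_succ_real k
    rw [prod_range_succ']
    have e : ∀ j : ℕ, ((k + 1 : ℕ) : ℝ) - ((j + 1 : ℕ) + 1 / 2) = (k : ℝ) - (j + 1 / 2) :=
      fun j => by push_cast; ring
    simp only [e]
    rw [ih, Nat.factorial_succ]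
    push_cast
    rw [pow_succ]
    field_simp
    linear_combination (-2 : ℝ) * h

lemma prod_range_neg_add_half (m : ℕ) :
    ∏ j ∈ range m, (-((j : ℝ) + 1 / 2)) =
      (-1) ^ m * (m.centralBinom * m.factorial / 4 ^ m) := by
  induction m with
  | zero => simp
  | succ m ih =>
    have h := centralBinom_succ_real m
    rw [prod_range_succ, ih, Nat.factorial_succ]
    push_cast
    rw [pow_succ, pow_succ]
    field_simp
    linear_combination (2 : ℝ) * h

lemma prod_range_half_nodes (k m : ℕ) :
    ∏ j ∈ range (k + m), ((k : ℝ) - (j + 1 / 2)) =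
      (-1) ^ m * (k.centralBinom * k.factorial * (m.centralBinom * m.factorial)) /
        4 ^ (k + m) := by
  have e : ∀ j : ℕ, (k : ℝ) - ((k + j : ℕ) + 1 / 2) = -((j : ℝ) + 1 / 2) :=
    fun j => by push_cast; ring
  rw [prod_range_add, prod_range_sub_add_half]
  simp only [e]
  rw [prod_range_neg_add_half, pow_add]
  field_simp

lemma prod_range_erase_nodes (k m : ℕ) :
    ∏ j ∈ (range (k + m + 1)).erase k, ((k : ℝ) - j) =
      (-1) ^ m * (k.factorial * m.factorial) := by
  have h1 : ∀ j ∈ (range (k + m + 1)).erase k, ((k : ℝ) - j) =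
      if j = k then 1 else (k : ℝ) - j := fun j hj => by
    rw [if_neg (ne_of_mem_erase hj)]
  rw [prod_congr rfl h1, prod_erase _ (by simp), add_assoc, prod_range_add,
    prod_range_succ' _ m]
  have h2 : ∏ j ∈ range k, (if j = k then (1 : ℝ) else (k : ℝ) - j) = k.factorial := by
    rw [← prod_range_add_one_eq_factorial, ← prod_range_reflect]
    push_cast
    refine prod_congr rfl fun j hj => ?_
    have hj' := mem_range.1 hj
    rw [if_neg (by omega), Nat.cast_sub (by omega), Nat.cast_sub (by omega)]
    push_cast
    ring
  have h3 : ∏ j ∈ range m, (if k + (j + 1) = k then (1 : ℝ) else (k : ℝ) - (k + (j + 1) : ℕ)) =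
      (-1) ^ m * m.factorial := by
    rw [← prod_range_add_one_eq_factorial]
    push_cast
    rw [← card_range m, ← prod_const, card_range, ← prod_mul_distrib]
    refine prod_congr rfl fun j _ => ?_
    rw [if_neg (by omega)]
    ring
  rw [h2, h3]
  simp
  ring

open Polynomial in
lemma sum_centralBinom_div_eq_zero {n i : ℕ} (hi : i < n) :
    ∑ k ∈ range (n + 1), (k.centralBinom : ℝ) * (n - k).centralBinom *
      (1 / (2 * ((i : ℝ) - k) + 1)) = 0 := by
  set P : ℝ[X] := Lagrange.nodal (range n) fun j : ℕ => (j : ℝ) + 1 / 2 with hP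
  set v : ℕ → ℝ := fun j => (j : ℝ) with hv
  have hinj : Set.InjOn v (range (n + 1)) := fun a _ b _ h => Nat.cast_injective h
  have hdeg : P.degree < #(range (n + 1)) := by
    rw [hP, Lagrange.degree_nodal, card_range, card_range]
    exact_mod_cast Nat.lt_succ_self n
  set t : ℝ := (i : ℝ) + 1 / 2 with ht
  have htv : ∀ k ∈ range (n + 1), t ≠ v k := fun k _ h => by
    have h2 : (2 * i + 1 : ℝ) = 2 * k := by simp only [ht, hv] at h; linarith
    have h3 : 2 * i + 1 = 2 * k := by exact_mod_cast h2
    omega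
  have h := Lagrange.eval_interpolate_not_at_node (r := fun k => P.eval (v k)) htv
  rw [← Lagrange.eq_interpolate hinj hdeg] at h
  have hPt : P.eval t = 0 :=
    Lagrange.eval_nodal_at_node (v := fun j : ℕ => (j : ℝ) + 1 / 2) (mem_range.2 hi)
  rw [hPt, zero_eq_mul, or_iff_right (Lagrange.eval_nodal_not_at_node htv)] at h
  have hterm : ∀ k ∈ range (n + 1),
      (k.centralBinom : ℝ) * (n - k).centralBinom * (1 / (2 * ((i : ℝ) - k) + 1)) =
      4 ^ n / 2 * (Lagrange.nodalWeight (range (n + 1)) v k * (t - v k)⁻¹ * P.eval (v k)) := by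
    intro k hk
    obtain ⟨m, rfl⟩ := Nat.exists_eq_add_of_le (Nat.lt_succ_iff.1 (mem_range.1 hk))
    have htk : t - v k ≠ 0 := sub_ne_zero.2 (htv k hk)
    have e : 2 * ((i : ℝ) - k) + 1 = 2 * (t - v k) := by simp only [ht, hv]; ring
    rw [e, Lagrange.nodalWeight, prod_inv_distrib, hP, Lagrange.eval_nodal]
    simp only [hv] at htk ⊢
    rw [prod_range_erase_nodes, prod_range_half_nodes, Nat.add_sub_cancel_left]
    have f1 : (k.factorial : ℝ) ≠ 0 := by positivity
    have f2 : (m.factorial : ℝ) ≠ 0 := by positivity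
    have f3 : ((-1 : ℝ) ^ m) ≠ 0 := by simp
    field_simp
  rw [sum_congr rfl hterm, ← mul_sum, h, mul_zero]

lemma sum_centralBinom_mul_oddHarmonic_sub {n i : ℕ} (hi : i ≤ n) :
    ∑ k ∈ range (n + 1), (k.centralBinom : ℝ) * (n - k).centralBinom *
      oddHarmonic ((i : ℤ) - k) = 4 ^ n * harmonic n / 2 := by
  induction i with
  | zero =>
    simp only [Nat.cast_zero, zero_sub, oddHarmonic_neg]
    exact sum_centralBinom_mul_centralBinom_mul_oddHarmonic n
  | succ i ih =>
    rw [← ih (by omega), ← sub_eq_zero, ← sum_sub_distrib,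
      ← sum_centralBinom_div_eq_zero (Nat.lt_of_succ_le hi)]
    refine sum_congr rfl fun k _ => ?_
    have h := oddHarmonic_add_one ((i : ℤ) - k)
    rw [← mul_sub, show ((i + 1 : ℕ) : ℤ) - k = (i : ℤ) - k + 1 by push_cast; ring, h]
    push_cast
    rfl

lemma Q_eq_sum_range (n : ℕ) (z : ℕ → ℝ) :
    Q n (fun k => z k) =
      (Real.log (2 * Real.pi) + Real.eulerMascheroniConstant + 2 * Real.log 2) *
        (∑ i ∈ range (n + 1), z i) ^ 2 -
      2 * ∑ i ∈ range (n + 1), ∑ j ∈ range (n + 1), z i * z j * oddHarmonic ((i : ℤ) - j) := by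
  unfold Q
  simp only [digamma_one_half_add_abs_sub]
  rw [Fin.sum_univ_eq_sum_range z]
  have h1 : ∀ i : ℕ, ∑ j : Fin (n + 1), z i * z j *
      (-Real.eulerMascheroniConstant - 2 * Real.log 2 + 2 * oddHarmonic ((i : ℤ) - (j : ℕ))) =
      ∑ j ∈ range (n + 1), z i * z j *
      (-Real.eulerMascheroniConstant - 2 * Real.log 2 + 2 * oddHarmonic ((i : ℤ) - j)) := fun i =>
    Fin.sum_univ_eq_sum_range (fun j => z i * z j *
      (-Real.eulerMascheroniConstant - 2 * Real.log 2 + 2 * oddHarmonic ((i : ℤ) - j))) (n + 1)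
  simp only [h1]
  rw [Fin.sum_univ_eq_sum_range (fun i => ∑ j ∈ range (n + 1), z i * z j *
      (-Real.eulerMascheroniConstant - 2 * Real.log 2 + 2 * oddHarmonic ((i : ℤ) - j))) (n + 1),
    sq, sum_mul_sum]
  simp only [mul_sum, ← sum_sub_distrib]
  exact sum_congr rfl fun i _ => sum_congr rfl fun j _ => by ring

/-- Decomposition of the quadratic form along the vector with constant image. -/
lemma Q_add_smul (n : ℕ) (y : ℕ → ℝ) (hy : ∑ i ∈ range (n + 1), y i = 0) (α : ℝ) :
    Q n (fun k => y k + α * (k.1.centralBinom * (n - k.1).centralBinom)) =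
      (α * 4 ^ n) ^ 2 * (Real.log (2 * Real.pi) + Real.eulerMascheroniConstant +
        2 * Real.log 2 - harmonic n) -
      2 * ∑ i ∈ range (n + 1), ∑ j ∈ range (n + 1), y i * y j * oddHarmonic ((i : ℤ) - j) := by
  set w : ℕ → ℝ := fun k => k.centralBinom * (n - k).centralBinom with hw
  have hsum : ∑ i ∈ range (n + 1), w i = 4 ^ n := sum_centralBinom_mul_centralBinom n
  have hconst : ∀ i ∈ range (n + 1), ∑ j ∈ range (n + 1), w j * oddHarmonic ((i : ℤ) - j) =
      4 ^ n * harmonic n / 2 := fun i hi =>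
    sum_centralBinom_mul_oddHarmonic_sub (Nat.lt_succ_iff.1 (mem_range.1 hi))
  have hbil : ∀ u : ℕ → ℝ, ∑ i ∈ range (n + 1), ∑ j ∈ range (n + 1),
      u i * w j * oddHarmonic ((i : ℤ) - j) =
      (∑ i ∈ range (n + 1), u i) * (4 ^ n * harmonic n / 2) := fun u => by
    rw [sum_mul]
    refine sum_congr rfl fun i hi => ?_
    rw [← hconst i hi, mul_sum]
    exact sum_congr rfl fun j _ => by ring
  have hbil' : ∑ i ∈ range (n + 1), ∑ j ∈ range (n + 1),
      w i * y j * oddHarmonic ((i : ℤ) - j) = 0 := by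
    have h := hbil y
    rw [hy, zero_mul, sum_comm] at h
    rw [← h]
    refine sum_congr rfl fun i _ => sum_congr rfl fun j _ => ?_
    rw [← oddHarmonic_neg, neg_sub]
    ring
  have hexp : ∑ i ∈ range (n + 1), ∑ j ∈ range (n + 1),
      (y i + α * w i) * (y j + α * w j) * oddHarmonic ((i : ℤ) - j) =
      ∑ i ∈ range (n + 1), ∑ j ∈ range (n + 1), y i * y j * oddHarmonic ((i : ℤ) - j) +
      α * ∑ i ∈ range (n + 1), ∑ j ∈ range (n + 1), y i * w j * oddHarmonic ((i : ℤ) - j) +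
      α * ∑ i ∈ range (n + 1), ∑ j ∈ range (n + 1), w i * y j * oddHarmonic ((i : ℤ) - j) +
      α ^ 2 * ∑ i ∈ range (n + 1), ∑ j ∈ range (n + 1),
        w i * w j * oddHarmonic ((i : ℤ) - j) := by
    simp only [mul_sum, ← sum_add_distrib]
    exact sum_congr rfl fun i _ => sum_congr rfl fun j _ => by ring
  rw [Q_eq_sum_range n fun k => y k + α * w k, hexp, hbil, hbil, hbil', sum_add_distrib, ← mul_sum,
    hsum, hy]
  ring

lemma Q_pos {n : ℕ} (hn : n ≤ 24) {x : Fin (n + 1) → ℝ} (hx : x ≠ 0) : 0 < Q n x := by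
  have hL := (harmonic_mono hn).trans_lt harmonic_lt_threshold
  obtain ⟨z, hz⟩ : ∃ z : ℕ → ℝ, x = fun k => z k.1 :=
    ⟨fun k => if h : k < n + 1 then x ⟨k, h⟩ else 0, by ext k; simp [k.is_le]⟩
  set w : ℕ → ℝ := fun k => k.centralBinom * (n - k).centralBinom with hw
  have hsum : ∑ i ∈ range (n + 1), w i = 4 ^ n := sum_centralBinom_mul_centralBinom n
  set α : ℝ := (∑ i ∈ range (n + 1), z i) / 4 ^ n with hα
  set y : ℕ → ℝ := fun k => z k - α * w k with hydef
  have hy : ∑ i ∈ range (n + 1), y i = 0 := by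
    rw [hydef, sum_sub_distrib, ← mul_sum, hsum, hα]
    field_simp
    ring
  have hQ := Q_add_smul n y hy α
  have hxy : x = fun k : Fin (n + 1) => y k + α * (k.1.centralBinom * (n - k.1).centralBinom) := by
    rw [hz]; ext k; simp [hydef, hw]
  rw [hxy, hQ]
  by_cases hne : ∃ k ≤ n, y k ≠ 0
  · have h1 := sum_mul_oddHarmonic_neg hy hne
    have h2 := mul_nonneg (sq_nonneg (α * 4 ^ n)) (sub_nonneg.2 hL.le)
    linarith
  · push Not at hne
    have h0 : ∑ i ∈ range (n + 1), ∑ j ∈ range (n + 1), y i * y j * oddHarmonic ((i : ℤ) - j) =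
        0 := sum_eq_zero fun i hi => sum_eq_zero fun j _ => by
      rw [hne i (Nat.lt_succ_iff.1 (mem_range.1 hi))]; ring
    have hα0 : α ≠ 0 := fun h => hx (by
      rw [hxy]; ext k; simp [h, hne k (Nat.lt_succ_iff.1 k.2)])
    rw [h0, mul_zero, sub_zero]
    exact mul_pos (by positivity) (sub_pos.2 hL)

lemma Q_centralBinom_neg {n : ℕ} (hn : 25 ≤ n) :
    Q n (fun k => (Nat.choose (2 * k.1) k.1 : ℝ) *
      (Nat.choose (2 * (n - k.1)) (n - k.1) : ℝ)) < 0 := by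
  have hL := threshold_lt_harmonic.trans_le (harmonic_mono hn)
  have h := Q_add_smul n (fun _ => 0) (by simp) 1
  simp only [zero_add, one_mul, zero_mul, sum_const_zero, mul_zero, sub_zero,
    Nat.centralBinom_eq_two_mul_choose] at h
  rw [h]
  exact mul_neg_of_pos_of_neg (by positivity) (sub_neg.2 hL)

theorem stmt_18 (n : ℕ) :
    (n ≤ 24 → ∀ x : Fin (n + 1) → ℝ, x ≠ 0 → 0 < Q n x) ∧
    (25 ≤ n → ¬ (∀ x : Fin (n + 1) → ℝ, x ≠ 0 → 0 < Q n x)) ∧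
    (25 ≤ n →
      Q n (fun k => (Nat.choose (2 * k.1) k.1 : ℝ) *
        (Nat.choose (2 * (n - k.1)) (n - k.1) : ℝ)) < 0) := by
  refine ⟨fun hn x hx => Q_pos hn hx, fun hn h => ?_, fun hn => Q_centralBinom_neg hn⟩
  refine (Q_centralBinom_neg hn).not_gt (h _ fun h0 => ?_)
  have h1 := congrFun h0 0
  have h2 : ((2 * n).choose n : ℝ) ≠ 0 :=
    Nat.cast_ne_zero.2 (Nat.choose_pos (by omega)).ne'
  simp at h1
  exact h2 (by exact_mod_cast h1)
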